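/- Let G = (V₁,E₁) be a connected graph with |V₁| ≥ 2 and H = (V₂,E₂) an arbitrary graph with |V₂| ≥ 1, with adjacency matrix A_H. If −2 − ψ_{H*}⁻¹(QEC(G)) ∉ ev(A_H), then QEC(G⊙H) = max{ ψ_{H*}⁻¹(QEC(G)), γ₃ }, where γ₃ = max( λ(S_{G⊙H}) ∩ {λ ∈ ℝ : det(A_H + (2+λ)I) = 0} ), with the convention that γ₃ is omitted (γ₃ = −∞) if this set is empty. -/

import Mathlib

open scoped BigOperators
open Filter Topology
open scoped Classical

namespace QECPaper

/-- The cone (join) `K₁ + H` over a graph `H`: vertex `none` is the apex. -/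
def cone {V₂ : Type*} (H : SimpleGraph V₂) : SimpleGraph (Option V₂) where
  Adj x y := (∃ a b, x = some a ∧ y = some b ∧ H.Adj a b) ∨
    (x = none ∧ y ≠ none) ∨ (x ≠ none ∧ y = none)
  symm := by
    refine ⟨?_⟩
    rintro x y (⟨a, b, rfl, rfl, h⟩ | ⟨rfl, hy⟩ | ⟨hx, rfl⟩)
    · exact Or.inl ⟨b, a, rfl, rfl, h.symm⟩
    · exact Or.inr (Or.inr ⟨hy, rfl⟩)
    · exact Or.inr (Or.inl ⟨rfl, hx⟩)
  loopless := by
    refine ⟨?_⟩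
    rintro x (⟨a, b, rfl, hb, h⟩ | ⟨rfl, hy⟩ | ⟨hx, rfl⟩)
    · exact H.loopless.irrefl a (by cases hb; exact h)
    · exact hy rfl
    · exact hx rfl

/-- The corona `G ⊙ H` of two graphs, realized on `V₁ × ({o} ∪ V₂)`
with `o = none`. -/
def corona {V₁ V₂ : Type*} (G : SimpleGraph V₁) (H : SimpleGraph V₂) :
    SimpleGraph (V₁ × Option V₂) where
  Adj p q := (p.1 = q.1 ∧ (cone H).Adj p.2 q.2) ∨
    (G.Adj p.1 q.1 ∧ p.2 = none ∧ q.2 = none)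
  symm := by
    refine ⟨?_⟩
    rintro ⟨i, x⟩ ⟨j, y⟩ (⟨h1, h2⟩ | ⟨h1, h2, h3⟩)
    · exact Or.inl ⟨h1.symm, (cone H).symm.symm _ _ h2⟩
    · exact Or.inr ⟨h1.symm, h3, h2⟩
  loopless := by
    refine ⟨?_⟩
    rintro ⟨i, x⟩ (⟨h1, h2⟩ | ⟨h1, h2, h3⟩)
    · exact (cone H).loopless.irrefl x h2
    · exact G.loopless.irrefl i h1

/-- The quadratic embedding constant of a (connected) graph on a finite vertex set. -/
noncomputable def QEC {V : Type*} [Fintype V] (G : SimpleGraph V) : ℝ :=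
  sSup {r : ℝ | ∃ f : V → ℝ, (∑ x, f x ^ 2) = 1 ∧ (∑ x, f x) = 0 ∧
    r = ∑ x, ∑ y, f x * (G.dist x y : ℝ) * f y}

/-- The set `λ(S)` of `λ` appearing in a solution of the basic equations. -/
def lambdaS {V : Type*} [Fintype V] (G : SimpleGraph V) : Set ℝ :=
  {lam : ℝ | ∃ (f : V → ℝ) (μ : ℝ),
    (∀ x, (∑ y, (G.dist x y : ℝ) * f y) - lam * f x = μ / 2) ∧
    (∑ x, f x) = 0 ∧ (∑ x, f x ^ 2) = 1}

/-- The distance matrix of a graph, with real entries. -/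
noncomputable def distMatrix {V : Type*} (G : SimpleGraph V) : Matrix V V ℝ :=
  Matrix.of fun x y => (G.dist x y : ℝ)

section MatrixFunctions

variable {ι : Type*} [Fintype ι] [DecidableEq ι]

/-- The eigenspace `ker (A - α)` inside `EuclideanSpace ℝ ι`. -/
noncomputable def eigSpace (A : Matrix ι ι ℝ) (α : ℝ) :
    Submodule ℝ (EuclideanSpace ℝ ι) :=
  LinearMap.ker (Matrix.toEuclideanLin A - α • LinearMap.id)

/-- The all-ones vector of `EuclideanSpace ℝ ι`. -/
noncomputable def onesE (ι : Type*) [Fintype ι] : EuclideanSpace ℝ ι :=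
  (WithLp.equiv 2 (ι → ℝ)).symm (fun _ => 1)

/-- `‖E_α 𝟏‖²`, where `E_α` is the orthogonal projection of `EuclideanSpace ℝ ι`
onto the eigenspace `ker (A - α)`. -/
noncomputable def projNormSq (A : Matrix ι ι ℝ) (α : ℝ) : ℝ :=
  ‖(Submodule.orthogonalProjectionOnto (eigSpace A α) (onesE ι) : EuclideanSpace ℝ ι)‖ ^ 2

/-- The set of (real) eigenvalues of a matrix. -/
def evSet (A : Matrix ι ι ℝ) : Set ℝ :=
  {α : ℝ | ∃ v : ι → ℝ, v ≠ 0 ∧ A.mulVec v = α • v}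

/-- The set of main eigenvalues: those `α` with `E_α 𝟏 ≠ 0`. -/
def mainEv (A : Matrix ι ι ℝ) : Set ℝ := {α : ℝ | projNormSq A α ≠ 0}

/-- `k_A = |ev_M(A) \ {-2}|`. -/
noncomputable def kA (A : Matrix ι ι ℝ) : ℕ := (mainEv A \ {(-2 : ℝ)}).ncard

/-- The ω-function associated with the symmetric matrix `A`. -/
noncomputable def omegaFun (A : Matrix ι ι ℝ) (lam : ℝ) : ℝ :=
  1 + projNormSq A (-2) +
    ∑ᶠ α ∈ mainEv A \ {(-2 : ℝ)}, lam / (α + 2 + lam) * projNormSq A α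

/-- The (maximal) domain of the ω-function: the complement of its poles. -/
def omegaDomain (A : Matrix ι ι ℝ) : Set ℝ :=
  {lam : ℝ | ∀ α ∈ mainEv A \ {(-2 : ℝ)}, lam ≠ -α - 2}

/-- The set of zeroes of the ω-function (on its domain). -/
def omegaZeros (A : Matrix ι ι ℝ) : Set ℝ :=
  {lam : ℝ | lam ∈ omegaDomain A ∧ omegaFun A lam = 0}

/-- `λ*`, the largest zero of the ω-function. -/
noncomputable def lamStar (A : Matrix ι ι ℝ) : ℝ := sSup (omegaZeros A)

/-- The ψ-function associated with `A`: `ψ_A(λ) = λ/ω_A(λ)` extended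
analytically across the poles of `ω_A` by the value `0`. -/
noncomputable def psiFun (A : Matrix ι ι ℝ) (lam : ℝ) : ℝ :=
  if -lam - 2 ∈ mainEv A \ {(-2 : ℝ)} then 0 else lam / omegaFun A lam

/-- The inverse of the rightmost branch `ψ_{A*} = ψ_A ↾ (λ*, +∞)`:
`ψ_{A*}⁻¹(y)` is the unique `λ > λ*` with `ψ_A(λ) = y`. -/
noncomputable def psiStarInv (A : Matrix ι ι ℝ) (y : ℝ) : ℝ :=
  sSup {lam : ℝ | lamStar A < lam ∧ psiFun A lam = y}

end MatrixFunctions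


section RationalBranch

variable {S : Finset ℝ} {c : ℝ → ℝ} {w top : ℝ}

/-- `w + ∑ c k (t - top)/(t - k)`: the partial fraction sum `w/(t - top) + ∑ c k/(t - k)`
multiplied by `t - top`. -/
noncomputable def branchDenom (S : Finset ℝ) (c : ℝ → ℝ) (w top t : ℝ) : ℝ :=
  w + ∑ k ∈ S, c k * ((t - top) / (t - k))

lemma branchDenom_strictMonoOn (hS : S.Nonempty) (hc : ∀ k ∈ S, 0 < c k)
    (htop : ∀ k ∈ S, k < top) :
    StrictMonoOn (branchDenom S c w top) {t | ∀ k ∈ S, k < t} := by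
  intro a ha b hb hab
  unfold branchDenom
  have : ∑ k ∈ S, c k * ((a - top) / (a - k)) < ∑ k ∈ S, c k * ((b - top) / (b - k)) := by
    refine Finset.sum_lt_sum_of_nonempty hS fun k hk => ?_
    have h1 : 0 < a - k := sub_pos.2 (ha k hk)
    have h2 : 0 < b - k := sub_pos.2 (hb k hk)
    refine mul_lt_mul_of_pos_left ?_ (hc k hk)
    rw [div_lt_div_iff₀ h1 h2]
    nlinarith [htop k hk]
  linarith

lemma branchDenom_continuousOn :
    ContinuousOn (branchDenom S c w top) {t | ∀ k ∈ S, k < t} := by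
  unfold branchDenom
  refine continuousOn_const.add (continuousOn_finsetSum _ fun k hk => ?_)
  refine continuousOn_const.mul (ContinuousOn.div (by fun_prop) (by fun_prop) ?_)
  intro t ht
  exact (sub_pos.2 (ht k hk)).ne'

lemma branchDenom_exists_zero (hS : S.Nonempty) (hc : ∀ k ∈ S, 0 < c k)
    (htop : ∀ k ∈ S, k < top) (hw : 0 < w) :
    ∃ z, z < top ∧ (∀ k ∈ S, k < z) ∧ branchDenom S c w top z = 0 := by
  set m := S.max' hS
  have hmS : m ∈ S := S.max'_mem hS
  have hmtop := htop m hmS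
  have hcm := hc m hmS
  set e := min ((top - m) / 2) (c m * (top - m) / (2 * w))
  have he0 : 0 < e := lt_min (by linarith) (by have := sub_pos.2 hmtop; positivity)
  have he1 : e ≤ (top - m) / 2 := min_le_left _ _
  have he2 : e * (2 * w) ≤ c m * (top - m) := by
    rw [← le_div_iff₀ (by positivity)]; exact min_le_right _ _
  have hlt : ∀ t, m < t → ∀ k ∈ S, k < t := fun t ht k hk => (S.le_max' k hk).trans_lt ht
  have hneg : branchDenom S c w top (m + e) ≤ 0 := by
    unfold branchDenom
    have hle : ∑ k ∈ S, c k * ((m + e - top) / (m + e - k)) ≤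
        c m * ((m + e - top) / (m + e - m)) := by
      rw [← Finset.add_sum_erase S _ hmS]
      have : ∑ k ∈ S.erase m, c k * ((m + e - top) / (m + e - k)) ≤ 0 := by
        refine Finset.sum_nonpos fun k hk => ?_
        have hk' := Finset.mem_of_mem_erase hk
        have := hlt (m + e) (by linarith) k hk'
        exact mul_nonpos_of_nonneg_of_nonpos (hc k hk').le
          (div_nonpos_of_nonpos_of_nonneg (by linarith) (by linarith))
      linarith
    have h3 : c m * ((m + e - top) / (m + e - m)) ≤ -w := by
      rw [← mul_div_assoc, div_le_iff₀ (by linarith)]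
      nlinarith
    linarith
  have hpos : 0 < branchDenom S c w top top := by simp [branchDenom, hw]
  have hmem : ∀ t ∈ Set.Icc (m + e) top, ∀ k ∈ S, k < t := fun t ht =>
    hlt t (by linarith [ht.1])
  obtain ⟨z, hz, hz0⟩ := intermediate_value_Icc (by linarith : m + e ≤ top)
    (branchDenom_continuousOn.mono hmem) ⟨hneg, hpos.le⟩
  refine ⟨z, lt_of_le_of_ne hz.2 ?_, hmem z hz, hz0⟩
  rintro rfl
  exact hpos.ne' hz0

lemma branch_strictMonoOn (hS : S.Nonempty) (hc : ∀ k ∈ S, 0 < c k)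
    (htop : ∀ k ∈ S, k < top) (hw : 0 < w) {z : ℝ} (hzS : ∀ k ∈ S, k < z)
    (hz0 : branchDenom S c w top z = 0) :
    StrictMonoOn (fun t => (t - top) / branchDenom S c w top t) (Set.Ioi z) := by
  have hpos : ∀ t, z < t → 0 < branchDenom S c w top t := fun t ht =>
    hz0 ▸ branchDenom_strictMonoOn hS hc htop hzS (fun k hk => (hzS k hk).trans ht) ht
  intro a ha b hb hab
  have ha' := hpos a ha
  have hb' := hpos b hb
  rw [Set.mem_Ioi] at ha hb
  show (a - top) / _ < (b - top) / _
  rw [div_lt_div_iff₀ ha' hb']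
  by_cases hcase : a < top ∧ top < b
  · nlinarith [mul_pos (sub_pos.2 hcase.2) ha', mul_pos (sub_pos.2 hcase.1) hb']
  have hprod : 0 ≤ (a - top) * (b - top) := by
    by_cases h : a < top
    · have : b ≤ top := by by_contra h'; exact hcase ⟨h, not_le.1 h'⟩
      nlinarith
    · nlinarith
  have key : (b - top) * branchDenom S c w top a - (a - top) * branchDenom S c w top b =
      w * (b - a) + ∑ k ∈ S, c k * ((a - top) * (b - top) * (1 / (a - k) - 1 / (b - k))) := by
    unfold branchDenom
    rw [mul_add, mul_add, Finset.mul_sum, Finset.mul_sum, add_sub_add_comm,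
      ← Finset.sum_sub_distrib]
    congr 1
    · ring
    · exact Finset.sum_congr rfl fun k _ => by ring
  have hsum : 0 ≤ ∑ k ∈ S, c k * ((a - top) * (b - top) * (1 / (a - k) - 1 / (b - k))) := by
    refine Finset.sum_nonneg fun k hk => mul_nonneg (hc k hk).le (mul_nonneg hprod ?_)
    have := hzS k hk
    exact sub_nonneg.2 (one_div_le_one_div_of_le (by linarith) (by linarith))
  nlinarith [mul_pos hw (sub_pos.2 hab)]

lemma branch_exists_eq (hS : S.Nonempty) (hc : ∀ k ∈ S, 0 < c k)
    (htop : ∀ k ∈ S, k < top) {z : ℝ} (hzt : z < top) (hzS : ∀ k ∈ S, k < z)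
    (hz0 : branchDenom S c w top z = 0) (y : ℝ) :
    ∃ t, z < t ∧ (t - top) / branchDenom S c w top t = y := by
  have hpos : ∀ t, z < t → 0 < branchDenom S c w top t := fun t ht =>
    hz0 ▸ branchDenom_strictMonoOn hS hc htop hzS (fun k hk => (hzS k hk).trans ht) ht
  set C := w + ∑ k ∈ S, c k
  have hbound : ∀ t, z < t → branchDenom S c w top t ≤ C := by
    intro t ht
    unfold branchDenom
    have : ∑ k ∈ S, c k * ((t - top) / (t - k)) ≤ ∑ k ∈ S, c k := by
      refine Finset.sum_le_sum fun k hk => ?_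
      refine mul_le_of_le_one_right (hc k hk).le ?_
      have h1 := hzS k hk
      have h2 := htop k hk
      rw [div_le_one (by linarith)]
      linarith
    linarith
  have hC0 : 0 < C := (hpos top hzt).trans_le (hbound top hzt)
  set B := top + |y| * C
  have hzB : z < B := by have := mul_nonneg (abs_nonneg y) hC0.le; linarith
  have hcont : ContinuousOn (fun t => t - top - y * branchDenom S c w top t) (Set.Icc z B) := by
    refine (by fun_prop : ContinuousOn (fun t : ℝ => t - top) _).sub
      (continuousOn_const.mul (branchDenom_continuousOn.mono ?_))
    exact fun t ht k hk => (hzS k hk).trans_le ht.1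
  have hBnonneg : 0 ≤ B - top - y * branchDenom S c w top B := by
    have h1 := hpos B hzB
    have h2 := hbound B hzB
    have h3 : y * branchDenom S c w top B ≤ |y| * C :=
      mul_le_mul (le_abs_self y) h2 h1.le (abs_nonneg y)
    linarith
  obtain ⟨t, ht, ht0⟩ := intermediate_value_Icc hzB.le hcont
    ⟨(by simp [hz0]; linarith : _ ≤ (0 : ℝ)), hBnonneg⟩
  have htz : z < t := by
    refine lt_of_le_of_ne ht.1 ?_
    rintro rfl
    simp [hz0] at ht0
    linarith
  refine ⟨t, htz, ?_⟩
  rw [div_eq_iff (hpos t htz).ne']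
  simp only at ht0
  linarith

end RationalBranch

section LagrangeMultiplier

variable {V : Type*} [Fintype V] (G : SimpleGraph V)

/-- The quadratic form of the distance matrix. -/
noncomputable def distForm (f : V → ℝ) : ℝ := ∑ x, ∑ y, f x * (G.dist x y : ℝ) * f y

lemma distForm_eq (f : V → ℝ) :
    distForm G f = ∑ x, f x * ∑ y, (G.dist x y : ℝ) * f y := by
  simp [distForm, Finset.mul_sum, mul_assoc]

lemma distForm_smul (a : ℝ) (f : V → ℝ) :
    distForm G (fun x => a * f x) = a ^ 2 * distForm G f := by
  simp only [distForm, Finset.mul_sum]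
  exact Finset.sum_congr rfl fun x _ => Finset.sum_congr rfl fun y _ => by ring

lemma distForm_add_smul (f g : V → ℝ) (t : ℝ) :
    distForm G (fun x => f x + t * g x) =
      distForm G f + 2 * t * (∑ x, g x * ∑ y, (G.dist x y : ℝ) * f y) + t ^ 2 * distForm G g := by
  have hsymm : ∑ x, ∑ y, f x * (G.dist x y : ℝ) * g y =
      ∑ x, ∑ y, g x * (G.dist x y : ℝ) * f y := by
    rw [Finset.sum_comm]
    refine Finset.sum_congr rfl fun x _ => Finset.sum_congr rfl fun y _ => ?_
    rw [G.dist_comm]; ring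
  have h2 : ∑ x, g x * ∑ y, (G.dist x y : ℝ) * f y =
      ∑ x, ∑ y, g x * (G.dist x y : ℝ) * f y := by
    simp [Finset.mul_sum, mul_assoc]
  have h3 : distForm G (fun x => f x + t * g x) = distForm G f +
      t * (∑ x, ∑ y, f x * (G.dist x y : ℝ) * g y) +
      t * (∑ x, ∑ y, g x * (G.dist x y : ℝ) * f y) + t ^ 2 * distForm G g := by
    simp only [distForm, Finset.mul_sum, ← Finset.sum_add_distrib]
    exact Finset.sum_congr rfl fun x _ => Finset.sum_congr rfl fun y _ => by ring
  rw [h3, hsymm, h2]; ring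

/-- The unit sphere of the hyperplane orthogonal to the all-ones vector. -/
def zeroSumSphere (V : Type*) [Fintype V] : Set (V → ℝ) :=
  {f | ∑ x, f x ^ 2 = 1 ∧ ∑ x, f x = 0}

lemma zeroSumSphere_isCompact : IsCompact (zeroSumSphere V) := by
  refine Metric.isCompact_of_isClosed_isBounded ?_ ?_
  · exact (isClosed_eq (by fun_prop) continuous_const).inter
      (isClosed_eq (by fun_prop) continuous_const)
  · refine (Metric.isBounded_closedBall (x := (0 : V → ℝ)) (r := 1)).subset fun f hf => ?_
    rw [mem_closedBall_zero_iff, pi_norm_le_iff_of_nonneg zero_le_one]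
    intro x
    rw [Real.norm_eq_abs, ← sq_le_one_iff_abs_le_one, ← hf.1]
    exact Finset.single_le_sum (f := fun x => f x ^ 2) (fun _ _ => sq_nonneg _)
      (Finset.mem_univ x)

lemma sum_sq_pos {f : V → ℝ} (hf : f ≠ 0) : 0 < ∑ y, f y ^ 2 := by
  obtain ⟨x, hx⟩ := Function.ne_iff.1 hf
  have hx' : f x ≠ 0 := hx
  exact Finset.sum_pos' (fun _ _ => sq_nonneg _) ⟨x, Finset.mem_univ x, by positivity⟩

lemma inv_sqrt_smul_mem_zeroSumSphere {f : V → ℝ} (hf : f ≠ 0) (h0 : ∑ x, f x = 0) :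
    (fun x => (√(∑ y, f y ^ 2))⁻¹ * f x) ∈ zeroSumSphere V := by
  have hpos := sum_sq_pos hf
  refine ⟨?_, ?_⟩
  · simp only [mul_pow, ← Finset.mul_sum, inv_pow, Real.sq_sqrt hpos.le]
    exact inv_mul_cancel₀ hpos.ne'
  · rw [← Finset.mul_sum, h0, mul_zero]

lemma zeroSumSphere_nonempty (hV : 2 ≤ Fintype.card V) : (zeroSumSphere V).Nonempty := by
  obtain ⟨a, b, hab⟩ := Fintype.exists_pair_of_one_lt_card hV
  refine ⟨_, inv_sqrt_smul_mem_zeroSumSphere (f := Pi.single a 1 - Pi.single b 1) ?_ ?_⟩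
  · intro h
    simpa [hab] using congrFun h a
  · simp

lemma QEC_eq_sSup_image : QEC G = sSup (distForm G '' zeroSumSphere V) := by
  unfold QEC
  congr 1
  ext r
  constructor
  · rintro ⟨f, h1, h2, h3⟩
    exact ⟨f, ⟨h1, h2⟩, h3.symm⟩
  · rintro ⟨f, ⟨h1, h2⟩, h3⟩
    exact ⟨f, h1, h2, h3.symm⟩

lemma distForm_continuous : Continuous (distForm G) := by
  unfold distForm
  fun_prop

lemma distForm_le_QEC {f : V → ℝ} (hf : f ∈ zeroSumSphere V) : distForm G f ≤ QEC G := by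
  rw [QEC_eq_sSup_image]
  exact le_csSup (zeroSumSphere_isCompact.image (distForm_continuous G)).bddAbove ⟨f, hf, rfl⟩

lemma distForm_le_QEC_mul (f : V → ℝ) (h0 : ∑ x, f x = 0) :
    distForm G f ≤ QEC G * ∑ x, f x ^ 2 := by
  by_cases hf : f = 0
  · simp [hf, distForm]
  · have h1 := distForm_le_QEC G (inv_sqrt_smul_mem_zeroSumSphere hf h0)
    have h2 := sum_sq_pos hf
    rw [distForm_smul, inv_pow, Real.sq_sqrt h2.le, inv_mul_le_iff₀ h2] at h1
    linarith

lemma le_QEC_of_mem_lambdaS {lam : ℝ} (h : lam ∈ lambdaS G) : lam ≤ QEC G := by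
  obtain ⟨f, μ, h1, h2, h3⟩ := h
  have h4 : distForm G f = lam := by
    rw [distForm_eq]
    calc ∑ x, f x * ∑ y, (G.dist x y : ℝ) * f y = ∑ x, (lam * f x ^ 2 + μ / 2 * f x) :=
          Finset.sum_congr rfl fun x _ => by rw [← h1 x]; ring
      _ = lam := by rw [Finset.sum_add_distrib, ← Finset.mul_sum, ← Finset.mul_sum, h2, h3]; ring
  exact h4 ▸ distForm_le_QEC G ⟨h3, h2⟩

lemma mem_lambdaS_of_ne_zero {lam a : ℝ} {f : V → ℝ} (hf : f ≠ 0) (h0 : ∑ x, f x = 0)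
    (h : ∀ x, (∑ y, (G.dist x y : ℝ) * f y) - lam * f x = a) : lam ∈ lambdaS G := by
  have hs := inv_sqrt_smul_mem_zeroSumSphere hf h0
  refine ⟨_, 2 * ((√(∑ y, f y ^ 2))⁻¹ * a), fun x => ?_, hs.2, hs.1⟩
  rw [← h x]
  simp only [mul_left_comm _ (√(∑ y, f y ^ 2))⁻¹, ← Finset.mul_sum]
  ring

lemma QEC_mem_lambdaS (hV : 2 ≤ Fintype.card V) : QEC G ∈ lambdaS G := by
  obtain ⟨f, hf, hmax⟩ := zeroSumSphere_isCompact.exists_isMaxOn (zeroSumSphere_nonempty hV)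
    (distForm_continuous G).continuousOn
  have hq : distForm G f = QEC G := by
    refine le_antisymm (distForm_le_QEC G hf) ?_
    rw [QEC_eq_sSup_image]
    refine csSup_le ((zeroSumSphere_nonempty hV).image _) ?_
    rintro _ ⟨g, hg, rfl⟩
    exact hmax hg
  set r : V → ℝ := fun x => (∑ y, (G.dist x y : ℝ) * f y) - QEC G * f x with hr
  have horth : ∀ g : V → ℝ, ∑ x, g x = 0 → ∑ x, g x * r x = 0 := by
    intro g hg
    have hrg : ∑ x, g x * r x =
        (∑ x, g x * ∑ y, (G.dist x y : ℝ) * f y) - QEC G * ∑ x, g x * f x := by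
      rw [Finset.mul_sum, ← Finset.sum_sub_distrib]
      exact Finset.sum_congr rfl fun x _ => by simp only [hr]; ring
    have hquad : ∀ t : ℝ, 0 ≤
        (QEC G * ∑ x, g x ^ 2 - distForm G g) * (t * t) + (-2 * ∑ x, g x * r x) * t + 0 := by
      intro t
      have h1 := distForm_le_QEC_mul G (fun x => f x + t * g x)
        (by rw [Finset.sum_add_distrib, ← Finset.mul_sum, hf.2, hg]; ring)
      rw [distForm_add_smul, hq] at h1
      have h2 : ∑ x, (f x + t * g x) ^ 2 =
          1 + 2 * t * ∑ x, g x * f x + t ^ 2 * ∑ x, g x ^ 2 := by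
        rw [← hf.1, Finset.mul_sum, Finset.mul_sum, ← Finset.sum_add_distrib,
          ← Finset.sum_add_distrib]
        exact Finset.sum_congr rfl fun x _ => by ring
      rw [h2] at h1
      rw [hrg]
      nlinarith
    have := discrim_le_zero hquad
    unfold discrim at this
    nlinarith [sq_nonneg (∑ x, g x * r x)]
  obtain ⟨a⟩ : Nonempty V := Fintype.card_pos_iff.1 (by omega)
  refine ⟨f, 2 * r a, fun x => ?_, hf.2, hf.1⟩
  have := horth (Pi.single x 1 - Pi.single a 1) (by simp)
  simp [sub_mul, Finset.sum_sub_distrib, Pi.single_apply] at this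
  simp only [hr] at this ⊢
  linarith

end LagrangeMultiplier

section CoronaDistance

variable {V₁ V₂ : Type*} (G : SimpleGraph V₁) (H : SimpleGraph V₂)

/-- The distance in `G ⊙ H`, in terms of the distance in `G`. -/
noncomputable def coronaDist : V₁ × Option V₂ → V₁ × Option V₂ → ℕ
  | (i, none), (j, none) => G.dist i j
  | (i, none), (j, some _) => G.dist i j + 1
  | (i, some _), (j, none) => G.dist i j + 1
  | (i, some a), (j, some b) =>
    if i = j then (if a = b then 0 else if H.Adj a b then 1 else 2) else G.dist i j + 2

variable {G H}

lemma corona_adj_none_some (i : V₁) (a : V₂) : (corona G H).Adj (i, none) (i, some a) :=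
  Or.inl ⟨rfl, Or.inr (Or.inl ⟨rfl, by simp⟩)⟩

lemma corona_adj_some_some {i j : V₁} {a b : V₂} :
    (corona G H).Adj (i, some a) (j, some b) ↔ i = j ∧ H.Adj a b := by
  simp [corona, cone]

lemma corona_adj_none_none {i j : V₁} :
    (corona G H).Adj (i, none) (j, none) ↔ G.Adj i j := by
  simp [corona, cone]

lemma corona_adj_none_some_iff {i j : V₁} {a : V₂} :
    (corona G H).Adj (i, none) (j, some a) ↔ i = j := by
  simp [corona, cone]

/-- The inclusion of `G` into `G ⊙ H`. -/
def coronaInl (G : SimpleGraph V₁) (H : SimpleGraph V₂) : G →g corona G H where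
  toFun i := (i, none)
  map_rel' h := corona_adj_none_none.2 h

lemma corona_connected (hG : G.Connected) : (corona G H).Connected := by
  have hreach : ∀ i x, (corona G H).Reachable (i, x) (i, none) := by
    rintro i (_ | a)
    · exact SimpleGraph.Reachable.refl _
    · exact (corona_adj_none_some i a).symm.reachable
  obtain ⟨v⟩ := hG.nonempty
  refine (SimpleGraph.connected_iff _).2 ⟨?_, ⟨(v, none)⟩⟩
  rintro ⟨i, x⟩ ⟨j, y⟩
  exact ((hreach i x).trans ((hG.preconnected i j).map (coronaInl G H))).trans (hreach j y).symm

lemma coronaDist_le_succ (hG : G.Connected) {p q r : V₁ × Option V₂}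
    (h : (corona G H).Adj p q) : coronaDist G H p r ≤ coronaDist G H q r + 1 := by
  have htri : ∀ i j k, G.Adj i j → G.dist i k ≤ G.dist j k + 1 := by
    intro i j k hij
    have := hG.dist_triangle (u := i) (v := j) (w := k)
    rw [SimpleGraph.dist_eq_one_iff_adj.2 hij] at this
    omega
  obtain ⟨i, _ | a⟩ := p <;> obtain ⟨j, _ | b⟩ := q <;> obtain ⟨k, _ | c⟩ := r
  · exact htri i j k (corona_adj_none_none.1 h)
  · have := htri i j k (corona_adj_none_none.1 h)
    simp only [coronaDist]; omega
  · obtain rfl := corona_adj_none_some_iff.1 h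
    simp only [coronaDist]; omega
  · obtain rfl := corona_adj_none_some_iff.1 h
    simp only [coronaDist]
    by_cases hik : i = k
    · subst hik; simp
    · rw [if_neg hik]; omega
  · obtain rfl := corona_adj_none_some_iff.1 h.symm
    simp only [coronaDist]; omega
  · obtain rfl := corona_adj_none_some_iff.1 h.symm
    simp only [coronaDist]
    split_ifs <;> omega
  · obtain ⟨rfl, -⟩ := corona_adj_some_some.1 h
    simp only [coronaDist]; omega
  · obtain ⟨rfl, hab⟩ := corona_adj_some_some.1 h
    simp only [coronaDist]
    by_cases hik : i = k
    · rw [if_pos hik, if_pos hik]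
      by_cases hbc : b = c
      · subst hbc; simp [hab, hab.ne]
      · split_ifs <;> omega
    · rw [if_neg hik, if_neg hik]; omega

lemma coronaDist_le_length (hG : G.Connected) {p q : V₁ × Option V₂}
    (w : (corona G H).Walk p q) : coronaDist G H p q ≤ w.length := by
  induction w with
  | nil =>
    rename_i u
    obtain ⟨i, _ | a⟩ := u <;> simp [coronaDist]
  | cons h w ih =>
    rw [SimpleGraph.Walk.length_cons]
    exact (coronaDist_le_succ hG h).trans (by omega)

lemma corona_dist (hG : G.Connected) (p q : V₁ × Option V₂) :
    (corona G H).dist p q = coronaDist G H p q := by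
  have hc := corona_connected (H := H) hG
  apply le_antisymm
  · have hbase : ∀ i j, (corona G H).dist (i, none) (j, none) ≤ G.dist i j := by
      intro i j
      obtain ⟨w, hw⟩ := hG.exists_walk_length_eq_dist i j
      rw [← hw, ← SimpleGraph.Walk.length_map (coronaInl G H)]
      exact SimpleGraph.dist_le _
    have hone : ∀ i a, (corona G H).dist (i, none) (i, some a) = 1 := fun i a =>
      SimpleGraph.dist_eq_one_iff_adj.2 (corona_adj_none_some i a)
    have hone' : ∀ i a, (corona G H).dist (i, some a) (i, none) = 1 := fun i a =>
      SimpleGraph.dist_eq_one_iff_adj.2 (corona_adj_none_some i a).symm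
    obtain ⟨i, _ | a⟩ := p <;> obtain ⟨j, _ | b⟩ := q
    · exact hbase i j
    · refine (hc.dist_triangle (v := (j, none))).trans ?_
      rw [hone]
      exact Nat.add_le_add_right (hbase i j) 1
    · refine (hc.dist_triangle (v := (i, none))).trans ?_
      rw [hone', add_comm]
      exact Nat.add_le_add_right (hbase i j) 1
    · have hle : (corona G H).dist (i, some a) (j, some b) ≤ G.dist i j + 2 := by
        refine (hc.dist_triangle (v := (i, none))).trans ?_
        have := hc.dist_triangle (u := (i, none)) (v := (j, none)) (w := (j, some b))
        rw [hone] at this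
        rw [hone']
        have := hbase i j
        omega
      simp only [coronaDist]
      split_ifs with h1 h2 h3
      · subst h1 h2; simp
      · exact (SimpleGraph.dist_eq_one_iff_adj.2 (corona_adj_some_some.2 ⟨h1, h3⟩)).le
      · subst h1; simpa using hle
      · exact hle
  · obtain ⟨w, hw⟩ := hc.exists_walk_length_eq_dist p q
    rw [← hw]
    exact coronaDist_le_length hG w

variable [Fintype V₁] [Fintype V₂]

lemma sum_corona (f : V₁ × Option V₂ → ℝ) :
    ∑ p, f p = ∑ i, (f (i, none) + ∑ a, f (i, some a)) := by
  rw [Fintype.sum_prod_type]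
  exact Finset.sum_congr rfl fun i _ => Fintype.sum_option _

lemma sum_corona_dist_none (hG : G.Connected) (f : V₁ × Option V₂ → ℝ) (i : V₁) :
    ∑ q, ((corona G H).dist (i, none) q : ℝ) * f q =
      (∑ j, (G.dist i j : ℝ) * (f (j, none) + ∑ a, f (j, some a))) +
        ∑ j, ∑ a, f (j, some a) := by
  rw [sum_corona, ← Finset.sum_add_distrib]
  refine Finset.sum_congr rfl fun j _ => ?_
  simp only [corona_dist hG, coronaDist]
  push_cast
  simp only [add_mul, one_mul, Finset.sum_add_distrib, ← Finset.mul_sum]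
  ring

lemma sum_corona_dist_some [DecidableEq V₂] [DecidableRel H.Adj] (hG : G.Connected)
    {f : V₁ × Option V₂ → ℝ} (hf : ∑ p, f p = 0) (i : V₁) (a : V₂) :
    ∑ q, ((corona G H).dist (i, some a) q : ℝ) * f q =
      (∑ q, ((corona G H).dist (i, none) q : ℝ) * f q) -
        (2 * f (i, some a) + (H.adjMatrix ℝ).mulVec (fun b => f (i, some b)) a) := by
  have key : ∀ q, ((corona G H).dist (i, some a) q : ℝ) =
      ((corona G H).dist (i, none) q : ℝ) + 1 -
        (if q = (i, some a) then 2 else 0) -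
        (if q.1 = i then q.2.elim 0 (fun b => H.adjMatrix ℝ a b) else 0) := by
    rintro ⟨j, _ | b⟩
    · simp [corona_dist hG, coronaDist]
    · simp only [corona_dist hG, coronaDist, Prod.mk.injEq, Option.some.injEq, Option.elim_some,
        SimpleGraph.adjMatrix_apply]
      by_cases hij : i = j
      · subst hij
        by_cases hab : a = b
        · subst hab; simp; norm_num
        · have hba : b ≠ a := fun h => hab h.symm
          by_cases hadj : H.Adj a b <;> simp [hab, hba, hadj]
          norm_num
      · have hji : j ≠ i := fun h => hij h.symm
        simp [hij, hji]
        ring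
  simp only [key, sub_mul, add_mul, Finset.sum_sub_distrib, Finset.sum_add_distrib, one_mul, hf]
  have h1 : ∑ q, (if q = (i, some a) then (2 : ℝ) else 0) * f q = 2 * f (i, some a) := by
    simp [ite_mul]
  have h2 : ∑ q : V₁ × Option V₂,
      (if q.1 = i then q.2.elim 0 (fun b => H.adjMatrix ℝ a b) else 0) * f q =
      (H.adjMatrix ℝ).mulVec (fun b => f (i, some b)) a := by
    rw [sum_corona, Finset.sum_eq_single i]
    · simp only [if_true, Option.elim_none, Option.elim_some, zero_mul, zero_add]
      rfl
    · intro j _ hj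
      simp [hj]
    · simp
  rw [h1, h2]
  ring

end CoronaDistance

section MainEigenvalues

variable {ι : Type*} [Fintype ι] [DecidableEq ι] {A : Matrix ι ι ℝ}

lemma projNormSq_nonneg (α : ℝ) : 0 ≤ projNormSq A α := sq_nonneg _

lemma mem_eigSpace {α : ℝ} {v : EuclideanSpace ℝ ι} :
    v ∈ eigSpace A α ↔ Matrix.toEuclideanLin A v = α • v := by
  simp [eigSpace, sub_eq_zero]

lemma eigSpace_eq_eigenspace (α : ℝ) :
    eigSpace A α = Module.End.eigenspace (Matrix.toEuclideanLin A) α := by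
  ext v
  rw [mem_eigSpace, Module.End.mem_eigenspace_iff]

lemma hasEigenvalue_of_mem_mainEv {α : ℝ} (h : α ∈ mainEv A) :
    Module.End.HasEigenvalue (Matrix.toEuclideanLin A) α := by
  intro hbot
  have hbot' : eigSpace A α = ⊥ := (eigSpace_eq_eigenspace α).trans hbot
  apply h
  have hz : (Submodule.orthogonalProjectionOnto (eigSpace A α) (onesE ι) :
      EuclideanSpace ℝ ι) = 0 := (Submodule.mem_bot ℝ).1 (hbot'.le (Subtype.mem _))
  rw [projNormSq, hz]
  simp

lemma mainEv_subset_evSet : mainEv A ⊆ evSet A := by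
  intro α h
  obtain ⟨v, hv⟩ := (hasEigenvalue_of_mem_mainEv h).exists_hasEigenvector
  refine ⟨v.ofLp, fun h0 => hv.2 (by ext i; simpa using congrFun h0 i), ?_⟩
  have := hv.apply_eq_smul
  simpa using congrArg WithLp.ofLp this

lemma mainEv_finite : (mainEv A).Finite :=
  (Set.toFinite (Set.range fun μ : Module.End.Eigenvalues (Matrix.toEuclideanLin A) =>
    (μ : ℝ))).subset fun _ h => ⟨⟨_, hasEigenvalue_of_mem_mainEv h⟩, rfl⟩

/-- Spectral decomposition of the all-ones vector, over the main eigenvalues. -/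
lemma sum_projection_onesE (hA : A.IsHermitian) :
    ∑ α ∈ (mainEv_finite (A := A)).toFinset, (eigSpace A α).starProjection (onesE ι) =
      onesE ι := by
  have hT := Matrix.isSymmetric_toEuclideanLin_iff.mpr hA
  have htop : (⨆ μ : Module.End.Eigenvalues (Matrix.toEuclideanLin A),
      Module.End.eigenspace (Matrix.toEuclideanLin A) μ) = ⊤ := by
    rw [← Submodule.orthogonal_eq_bot_iff]
    exact hT.orthogonalComplement_iSup_eigenspaces_eq_bot'
  have hsum := hT.orthogonalFamily_eigenspaces'.sum_projection_of_mem_iSup (onesE ι)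
    (htop ▸ Submodule.mem_top)
  refine Eq.trans ?_ hsum
  have hinj : Function.Injective
      (fun μ : Module.End.Eigenvalues (Matrix.toEuclideanLin A) => (μ : ℝ)) :=
    Subtype.val_injective
  have himg : ∑ μ : Module.End.Eigenvalues (Matrix.toEuclideanLin A),
      (Module.End.eigenspace (Matrix.toEuclideanLin A) (μ : ℝ)).starProjection (onesE ι) =
      ∑ α ∈ Finset.univ.map ⟨_, hinj⟩, (eigSpace A α).starProjection (onesE ι) := by
    rw [Finset.sum_map]
    refine Finset.sum_congr rfl fun μ _ => ?_
    simp only [Function.Embedding.coeFn_mk, eigSpace_eq_eigenspace]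
  refine Eq.trans ?_ himg.symm
  refine Finset.sum_subset ?_ ?_
  · intro α hα
    rw [Set.Finite.mem_toFinset] at hα
    exact Finset.mem_map.2 ⟨⟨α, hasEigenvalue_of_mem_mainEv hα⟩, Finset.mem_univ _, rfl⟩
  · intro α _ hα
    rw [Set.Finite.mem_toFinset, mainEv, Set.mem_ofPred_eq, not_not, projNormSq, sq_eq_zero_iff,
      norm_eq_zero] at hα
    exact hα

lemma inner_starProjection_onesE (hA : A.IsHermitian) {lam α : ℝ} {u : ι → ℝ}
    (hu : A.mulVec u + (2 + lam) • u = fun _ => 1) (hα : α + 2 + lam ≠ 0) :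
    inner ℝ ((eigSpace A α).starProjection (onesE ι)) (WithLp.toLp 2 u) =
      projNormSq A α / (α + 2 + lam) := by
  have hT := Matrix.isSymmetric_toEuclideanLin_iff.mpr hA
  set w := (eigSpace A α).starProjection (onesE ι) with hw
  have hwmem : w ∈ eigSpace A α := Submodule.starProjection_apply_mem _ _
  have hnorm : inner ℝ w (onesE ι) = projNormSq A α := by
    exact Submodule.re_inner_starProjection_eq_normSq (𝕜 := ℝ) (eigSpace A α) (onesE ι)
  have hones : onesE ι = Matrix.toEuclideanLin A (WithLp.toLp 2 u) +
      (2 + lam) • WithLp.toLp 2 u := congrArg (WithLp.toLp 2) hu.symm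
  rw [hones, inner_add_right, ← hT, mem_eigSpace.1 hwmem,
    inner_smul_left, inner_smul_right] at hnorm
  rw [eq_div_iff hα, ← hnorm]
  simp
  ring

lemma sum_resolvent (hA : A.IsHermitian) {lam : ℝ} {u : ι → ℝ}
    (hu : A.mulVec u + (2 + lam) • u = fun _ => 1) (hev : -2 - lam ∉ evSet A) :
    ∑ i, u i = ∑ α ∈ (mainEv_finite (A := A)).toFinset, projNormSq A α / (α + 2 + lam) := by
  have h1 : ∑ i, u i = inner ℝ (onesE ι) (WithLp.toLp 2 u) := by
    simp [onesE, PiLp.inner_apply]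
  rw [h1]
  conv_lhs => rw [← sum_projection_onesE hA]
  rw [sum_inner]
  refine Finset.sum_congr rfl fun α hα => inner_starProjection_onesE hA hu ?_
  intro h0
  apply hev
  rw [Set.Finite.mem_toFinset] at hα
  rw [show -2 - lam = α by linarith]
  exact mainEv_subset_evSet hα

lemma omegaFun_eq_sum (lam : ℝ) :
    omegaFun A lam = 1 + projNormSq A (-2) +
      ∑ α ∈ (mainEv_finite (A := A)).toFinset.erase (-2),
        lam / (α + 2 + lam) * projNormSq A α := by
  unfold omegaFun
  congr 1
  rw [← finsum_mem_coe_finset]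
  congr! 3 with α
  simp

lemma omegaFun_eq_resolvent (hA : A.IsHermitian) {lam : ℝ} {u : ι → ℝ}
    (hu : A.mulVec u + (2 + lam) • u = fun _ => 1) (hev : -2 - lam ∉ evSet A) :
    omegaFun A lam = 1 + lam * ∑ i, u i := by
  have hval : lam * (projNormSq A (-2) / (-2 + 2 + lam)) = projNormSq A (-2) := by
    rcases eq_or_ne lam 0 with rfl | h
    · have : projNormSq A (-2) = 0 := by
        by_contra h
        exact hev (mainEv_subset_evSet (by simpa [mainEv] using h))
      simp [this]
    · rw [neg_add_cancel, zero_add, mul_div_cancel₀ _ h]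
  rw [omegaFun_eq_sum, sum_resolvent hA hu hev]
  have hsplit : lam * ∑ α ∈ (mainEv_finite (A := A)).toFinset, projNormSq A α / (α + 2 + lam) =
      projNormSq A (-2) + ∑ α ∈ (mainEv_finite (A := A)).toFinset.erase (-2),
        lam / (α + 2 + lam) * projNormSq A α := by
    rw [Finset.mul_sum]
    by_cases hmem : (-2 : ℝ) ∈ (mainEv_finite (A := A)).toFinset
    · rw [← Finset.add_sum_erase _ _ hmem, hval]
      congr 1
      exact Finset.sum_congr rfl fun α _ => by ring
    · have h0 : projNormSq A (-2) = 0 := by simpa [mainEv] using hmem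
      rw [Finset.erase_eq_of_notMem hmem, h0, zero_add]
      exact Finset.sum_congr rfl fun α _ => by ring
  rw [hsplit]
  ring

/-- A nonnegative matrix has a main eigenvalue different from `-2`. -/
lemma exists_mainEv_ne (hA : A.IsHermitian) (hnn : ∀ i j, 0 ≤ A i j) [Nonempty ι] :
    ∃ α ∈ mainEv A, α ≠ -2 := by
  by_contra! hcon
  have hmem : onesE ι ∈ eigSpace A (-2) := by
    rw [← sum_projection_onesE hA]
    refine Submodule.sum_mem _ fun α hα => ?_
    rw [Set.Finite.mem_toFinset] at hα
    rw [hcon α hα]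
    exact Submodule.starProjection_apply_mem _ _
  rw [mem_eigSpace] at hmem
  obtain ⟨i⟩ := ‹Nonempty ι›
  have := congrArg (fun v => v.ofLp i) hmem
  simp [onesE, Matrix.mulVec, dotProduct] at this
  have h2 : 0 ≤ ∑ j, A i j := Finset.sum_nonneg fun j _ => hnn i j
  linarith

end MainEigenvalues

section PsiBranch

variable {ι : Type*} [Fintype ι] [DecidableEq ι] {A : Matrix ι ι ℝ}

/-- The poles of `ω_A(λ)/λ`. -/
noncomputable def poles (A : Matrix ι ι ℝ) : Finset ℝ :=
  insert 0 (((mainEv_finite (A := A)).toFinset.erase (-2)).image fun α => -α - 2)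

/-- The residue of `ω_A(λ)/λ` at a pole `p`. -/
noncomputable def residue (A : Matrix ι ι ℝ) (p : ℝ) : ℝ :=
  projNormSq A (-p - 2) + if p = 0 then 1 else 0

lemma mem_poles {p : ℝ} : p ∈ poles A ↔ p = 0 ∨ -p - 2 ∈ mainEv A \ {(-2 : ℝ)} := by
  simp only [poles, Finset.mem_insert, Finset.mem_image, Finset.mem_erase,
    Set.Finite.mem_toFinset, Set.mem_sdiff, Set.mem_singleton_iff]
  refine or_congr_right ⟨?_, fun h => ⟨-p - 2, ⟨h.2, h.1⟩, by ring⟩⟩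
  rintro ⟨α, ⟨h1, h2⟩, rfl⟩
  rw [show -(-α - 2) - 2 = α by ring]
  exact ⟨h2, h1⟩

lemma residue_pos {p : ℝ} (hp : p ∈ poles A) : 0 < residue A p := by
  have hnn := projNormSq_nonneg (A := A) (-p - 2)
  unfold residue
  rcases mem_poles.1 hp with h | h
  · rw [if_pos h]; linarith
  · have : 0 < projNormSq A (-p - 2) := lt_of_le_of_ne hnn (Ne.symm h.1)
    split_ifs <;> linarith

lemma omegaFun_zero_pos : 0 < omegaFun A 0 := by
  rw [omegaFun_eq_sum]
  simp only [zero_div, zero_mul, Finset.sum_const_zero, add_zero]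
  linarith [projNormSq_nonneg (A := A) (-2)]

lemma omegaFun_eq_sum_poles {lam : ℝ} (h : lam ≠ 0) :
    omegaFun A lam = lam * ∑ p ∈ poles A, residue A p / (lam - p) := by
  rw [omegaFun_eq_sum, poles, Finset.sum_insert, Finset.sum_image, mul_add, Finset.mul_sum]
  · congr 1
    · simp only [residue, if_true, sub_zero, neg_zero, zero_sub]
      rw [mul_div_cancel₀ _ h, add_comm]
    · refine Finset.sum_congr rfl fun α hα => ?_
      have hne : ¬ (-α - 2 = 0) := fun h0 => (Finset.mem_erase.1 hα).1 (by linarith)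
      rw [residue, if_neg hne, show -(-α - 2) - 2 = α by ring,
        show lam - (-α - 2) = α + 2 + lam by ring]
      ring
  · intro α _ β _ hαβ
    simp only at hαβ
    linarith
  · simp only [Finset.mem_image, Finset.mem_erase, not_exists, not_and]
    intro α hα h0
    exact hα.1 (by linarith)

lemma omegaFun_eq_branchDenom {top lam : ℝ} (htop : top ∈ poles A) (h : lam ≠ 0)
    (hlam : lam ≠ top) :
    omegaFun A lam = lam * (branchDenom ((poles A).erase top) (residue A) (residue A top) top lam /
      (lam - top)) := by
  have h' := sub_ne_zero.2 hlam
  rw [omegaFun_eq_sum_poles h, ← Finset.add_sum_erase _ _ htop, branchDenom, add_div,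
    Finset.sum_div]
  congr 2
  refine Finset.sum_congr rfl fun k _ => ?_
  rw [mul_div_assoc, div_right_comm, div_self h', mul_one_div]

/-- The rightmost branch of `ψ_A` is an increasing bijection from `(λ*, ∞)` to `ℝ`. -/
lemma exists_psi_branch (hA : ∃ α ∈ mainEv A, α ≠ -2) :
    ∃ z, IsGreatest (omegaZeros A) z ∧ StrictMonoOn (psiFun A) (Set.Ioi z) ∧
      ∀ y, ∃ t, z < t ∧ psiFun A t = y := by
  have h0P : (0 : ℝ) ∈ poles A := mem_poles.2 (Or.inl rfl)
  have hne : (poles A).Nonempty := ⟨0, h0P⟩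
  set top := (poles A).max' hne
  have htopP : top ∈ poles A := Finset.max'_mem _ _
  set S := (poles A).erase top with hS_def
  have hSne : S.Nonempty := by
    obtain ⟨α, hα, hα2⟩ := hA
    have hp : -α - 2 ∈ poles A := mem_poles.2 (Or.inr ⟨by ring_nf; exact hα, by
      rw [Set.mem_singleton_iff]; intro h; exact hα2 (by linarith)⟩)
    by_cases h : top = 0
    · exact ⟨-α - 2, Finset.mem_erase.2 ⟨fun h' => hα2 (by linarith), hp⟩⟩
    · exact ⟨0, Finset.mem_erase.2 ⟨fun h' => h h'.symm, h0P⟩⟩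
  have hc : ∀ k ∈ S, 0 < residue A k := fun k hk => residue_pos (Finset.mem_of_mem_erase hk)
  have htop : ∀ k ∈ S, k < top := fun k hk =>
    lt_of_le_of_ne (Finset.le_max' _ _ (Finset.mem_of_mem_erase hk)) (Finset.ne_of_mem_erase hk)
  have hw := residue_pos htopP
  obtain ⟨z, hzt, hzS, hz0⟩ := branchDenom_exists_zero hSne hc htop hw
  have hpos : ∀ t, z < t → 0 < branchDenom S (residue A) (residue A top) top t := fun t ht =>
    hz0 ▸ branchDenom_strictMonoOn hSne hc htop hzS (fun k hk => (hzS k hk).trans ht) ht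
  have hpole : ∀ p ∈ poles A, z ≤ p → p = top := by
    intro p hp hzp
    by_contra hpt
    exact absurd (hzS p (Finset.mem_erase.2 ⟨hpt, hp⟩)) (not_lt.2 hzp)
  have hgreatest : IsGreatest (omegaZeros A) z := by
    have hzP : z ∉ poles A := fun h => hzt.ne (hpole z h le_rfl)
    have hz_ne : z ≠ 0 := fun h => hzP (h ▸ h0P)
    refine ⟨⟨fun α hα hz => hzP (mem_poles.2 (Or.inr ?_)), ?_⟩, ?_⟩
    · rwa [hz, show -(-α - 2) - 2 = α by ring]
    · rw [omegaFun_eq_branchDenom htopP hz_ne hzt.ne, hz0]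
      simp
    · rintro lam ⟨hdom, hzero⟩
      by_contra! hlt
      have hlam0 : lam ≠ 0 := by
        rintro rfl
        exact omegaFun_zero_pos.ne' hzero
      have hlamt : lam ≠ top := by
        intro h
        rcases mem_poles.1 htopP with h' | h'
        · exact hlam0 (h.trans h')
        · exact hdom _ h' (by linarith)
      rw [omegaFun_eq_branchDenom htopP hlam0 hlamt] at hzero
      exact mul_ne_zero hlam0 (div_ne_zero (hpos lam hlt).ne' (sub_ne_zero.2 hlamt)) hzero
  have hpsi : ∀ t, z < t →
      psiFun A t = (t - top) / branchDenom S (residue A) (residue A top) top t := by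
    intro t ht
    by_cases htt : t = top
    · rw [htt, sub_self, zero_div, psiFun]
      split_ifs with h
      · rfl
      · rw [(mem_poles.1 htopP).resolve_right h, zero_div]
    · have htP : t ∉ poles A := fun h => htt (hpole t h ht.le)
      have ht0 : t ≠ 0 := fun h => htP (h ▸ h0P)
      rw [psiFun, if_neg fun h => htP (mem_poles.2 (Or.inr h)),
        omegaFun_eq_branchDenom htopP ht0 htt, ← hS_def]
      have h1 := (hpos t ht).ne'
      have h2 := sub_ne_zero.2 htt
      field_simp
  refine ⟨z, hgreatest, (branch_strictMonoOn hSne hc htop hw hzS hz0).congr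
    fun t ht => (hpsi t ht).symm, fun y => ?_⟩
  obtain ⟨t, ht, hty⟩ := branch_exists_eq hSne hc htop hzt hzS hz0 y
  exact ⟨t, ht, (hpsi t ht).trans hty⟩

lemma isGreatest_lamStar (hA : ∃ α ∈ mainEv A, α ≠ -2) :
    IsGreatest (omegaZeros A) (lamStar A) := by
  obtain ⟨z, hz, -⟩ := exists_psi_branch hA
  rwa [lamStar, hz.csSup_eq]

lemma psiFun_strictMonoOn (hA : ∃ α ∈ mainEv A, α ≠ -2) :
    StrictMonoOn (psiFun A) (Set.Ioi (lamStar A)) := by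
  obtain ⟨z, hz, hmono, -⟩ := exists_psi_branch hA
  rwa [lamStar, hz.csSup_eq]

lemma psiStarInv_spec (hA : ∃ α ∈ mainEv A, α ≠ -2) (y : ℝ) :
    lamStar A < psiStarInv A y ∧ psiFun A (psiStarInv A y) = y := by
  obtain ⟨z, hz, hmono, hsurj⟩ := exists_psi_branch hA
  have hz' : lamStar A = z := hz.csSup_eq
  obtain ⟨t, ht, hty⟩ := hsurj y
  have hset : {lam : ℝ | lamStar A < lam ∧ psiFun A lam = y} = {t} := by
    ext s
    constructor
    · rintro ⟨h1, h2⟩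
      exact hmono.injOn (hz' ▸ h1) ht (h2.trans hty.symm)
    · rintro rfl
      exact ⟨hz' ▸ ht, hty⟩
  have : psiStarInv A y = t := by rw [psiStarInv, hset, csSup_singleton]
  rw [this, hz']
  exact ⟨ht, hty⟩

end PsiBranch

section CoronaEquations

variable {V₁ V₂ : Type*} [Fintype V₁] [Fintype V₂] [DecidableEq V₂]
  {G : SimpleGraph V₁} {H : SimpleGraph V₂} [DecidableRel H.Adj]

lemma shift_mulVec (A : Matrix V₂ V₂ ℝ) (lam : ℝ) (v : V₂ → ℝ) :
    (A + (2 + lam) • (1 : Matrix V₂ V₂ ℝ)).mulVec v = A.mulVec v + (2 + lam) • v := by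
  rw [Matrix.add_mulVec, Matrix.smul_mulVec, Matrix.one_mulVec]

lemma det_shift_eq_zero_iff (A : Matrix V₂ V₂ ℝ) (lam : ℝ) :
    (A + (2 + lam) • (1 : Matrix V₂ V₂ ℝ)).det = 0 ↔ -2 - lam ∈ evSet A := by
  rw [← Matrix.exists_mulVec_eq_zero_iff]
  refine exists_congr fun v => and_congr_right fun _ => ?_
  rw [shift_mulVec, add_eq_zero_iff_eq_neg, ← neg_smul, neg_add']

lemma exists_resolvent {A : Matrix V₂ V₂ ℝ} {lam : ℝ} (hev : -2 - lam ∉ evSet A) :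
    ∃ u : V₂ → ℝ, A.mulVec u + (2 + lam) • u = fun _ => 1 := by
  have hdet : IsUnit (A + (2 + lam) • (1 : Matrix V₂ V₂ ℝ)).det :=
    isUnit_iff_ne_zero.2 fun h => hev ((det_shift_eq_zero_iff A lam).1 h)
  refine ⟨(A + (2 + lam) • (1 : Matrix V₂ V₂ ℝ))⁻¹.mulVec fun _ => 1, ?_⟩
  rw [← shift_mulVec, Matrix.mulVec_mulVec, Matrix.mul_nonsing_inv _ hdet, Matrix.one_mulVec]

lemma psiFun_of_notMem {A : Matrix V₂ V₂ ℝ} {lam : ℝ} (hev : -2 - lam ∉ evSet A) :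
    psiFun A lam = lam / omegaFun A lam := by
  rw [psiFun, if_neg]
  intro h
  exact hev (by rw [show -2 - lam = -lam - 2 by ring]; exact mainEv_subset_evSet h.1)

lemma adjMatrix_isHermitian {V : Type*} {H : SimpleGraph V} [DecidableRel H.Adj] :
    (H.adjMatrix ℝ).IsHermitian := by
  ext i j
  simp [SimpleGraph.adjMatrix_apply, H.adj_comm]

lemma mem_lambdaS_corona (hG : G.Connected) {lam : ℝ}
    (hev : -2 - lam ∉ evSet (H.adjMatrix ℝ)) (hω : omegaFun (H.adjMatrix ℝ) lam ≠ 0)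
    (h : psiFun (H.adjMatrix ℝ) lam ∈ lambdaS G) : lam ∈ lambdaS (corona G H) := by
  obtain ⟨F, μ, hF, hF0, hF1⟩ := h
  obtain ⟨u, hu⟩ := exists_resolvent hev
  have hωu := omegaFun_eq_resolvent adjMatrix_isHermitian hu hev
  rw [psiFun_of_notMem hev] at hF
  set ω := omegaFun (H.adjMatrix ℝ) lam
  set f : V₁ × Option V₂ → ℝ := fun p => p.2.elim (F p.1 / ω) (fun a => lam * (F p.1 / ω) * u a)
    with hf
  have hrow : ∀ i, f (i, none) + ∑ a, f (i, some a) = F i := by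
    intro i
    simp only [hf, Option.elim_none, Option.elim_some, ← Finset.mul_sum]
    calc F i / ω + lam * (F i / ω) * ∑ a, u a = F i / ω * (1 + lam * ∑ a, u a) := by ring
      _ = F i := by rw [← hωu, div_mul_cancel₀ _ hω]
  have hsum : ∑ p, f p = 0 := by
    rw [sum_corona]
    simp only [hrow, hF0]
  have hne : f ≠ 0 := by
    intro h0
    have : ∀ i, F i = 0 := fun i => by rw [← hrow i, h0]; simp
    simp [this] at hF1
  have hnone : ∀ i, (∑ q, ((corona G H).dist (i, none) q : ℝ) * f q) - lam * (F i / ω) =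
      μ / 2 + ∑ j, ∑ a, f (j, some a) := by
    intro i
    rw [sum_corona_dist_none hG, ← hF i]
    simp only [hrow]
    ring
  refine mem_lambdaS_of_ne_zero _ hne hsum (a := μ / 2 + ∑ j, ∑ a, f (j, some a)) ?_
  rintro ⟨i, _ | a⟩
  · exact hnone i
  · rw [sum_corona_dist_some hG hsum, ← hnone i]
    have hua := congrFun hu a
    have hfa : (fun b => f (i, some b)) = (lam * (F i / ω)) • u := rfl
    rw [hfa, Matrix.mulVec_smul]
    simp only [Pi.add_apply, Pi.smul_apply, smul_eq_mul, hf, Option.elim_some] at hua ⊢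
    linear_combination -(lam * (F i / ω)) * hua

lemma psiFun_mem_lambdaS (hG : G.Connected) {lam : ℝ}
    (hev : -2 - lam ∉ evSet (H.adjMatrix ℝ)) (hω : omegaFun (H.adjMatrix ℝ) lam ≠ 0)
    (h : lam ∈ lambdaS (corona G H)) : psiFun (H.adjMatrix ℝ) lam ∈ lambdaS G := by
  obtain ⟨f, μ, hf, hf0, hf1⟩ := h
  obtain ⟨u, hu⟩ := exists_resolvent hev
  have hωu := omegaFun_eq_resolvent adjMatrix_isHermitian hu hev
  rw [psiFun_of_notMem hev]
  set ω := omegaFun (H.adjMatrix ℝ) lam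
  have hsome : ∀ i a, f (i, some a) = lam * f (i, none) * u a := by
    intro i
    by_contra hcon
    apply hev
    refine ⟨(fun a => f (i, some a)) - (lam * f (i, none)) • u, ?_, ?_⟩
    · intro h0
      exact hcon fun a => sub_eq_zero.1 (congrFun h0 a)
    · ext a
      have h1 := hf (i, none)
      have h2 := hf (i, some a)
      rw [sum_corona_dist_some hG hf0] at h2
      have hua := congrFun hu a
      rw [Matrix.mulVec_sub, Matrix.mulVec_smul]
      simp only [Pi.add_apply, Pi.sub_apply, Pi.smul_apply, smul_eq_mul] at hua ⊢
      linear_combination h1 - h2 - (lam * f (i, none)) * hua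
  have hrow : ∀ i, f (i, none) + ∑ a, f (i, some a) = f (i, none) * ω := by
    intro i
    simp only [hsome, ← Finset.mul_sum]
    rw [hωu]; ring
  refine mem_lambdaS_of_ne_zero (f := fun i => f (i, none) * ω) G
    (a := μ / 2 - ∑ j, ∑ a, f (j, some a)) ?_ ?_ ?_
  · intro h0
    have hz : ∀ i, f (i, none) = 0 := fun i => (mul_eq_zero.1 (congrFun h0 i)).resolve_right hω
    have : f = 0 := by
      ext ⟨i, _ | a⟩
      · exact hz i
      · simp [hsome, hz]
    simp [this] at hf1
  · rw [sum_corona] at hf0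
    simpa only [hrow] using hf0
  · intro i
    have h1 := hf (i, none)
    rw [sum_corona_dist_none hG] at h1
    simp only [hrow] at h1
    rw [← h1]
    rw [mul_comm (f (i, none)) ω, ← mul_assoc, div_mul_cancel₀ _ hω]
    ring

end CoronaEquations

/-- `QEC(G⊙H) = max{ψ_{H*}⁻¹(QEC(G)), γ₃}`, where `γ₃` is the
maximum of `λ(S_{G⊙H}) ∩ {det(A_H + (2+λ)I) = 0}` (omitted when this set is empty). -/
theorem qec_corona_with_gamma3 {V₁ V₂ : Type*} [Fintype V₁] [Fintype V₂] [DecidableEq V₂]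
    (G : SimpleGraph V₁) (H : SimpleGraph V₂) [DecidableRel H.Adj]
    (hG : G.Connected) (hV₁ : 2 ≤ Fintype.card V₁) (hV₂ : 1 ≤ Fintype.card V₂)
    (hev : -2 - psiStarInv (H.adjMatrix ℝ) (QEC G) ∉ evSet (H.adjMatrix ℝ)) :
    ((lambdaS (corona G H) ∩
        {lam : ℝ | (H.adjMatrix ℝ + (2 + lam) • (1 : Matrix V₂ V₂ ℝ)).det = 0}) = ∅ →
      QEC (corona G H) = psiStarInv (H.adjMatrix ℝ) (QEC G)) ∧
    ((lambdaS (corona G H) ∩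
        {lam : ℝ | (H.adjMatrix ℝ + (2 + lam) • (1 : Matrix V₂ V₂ ℝ)).det = 0}).Nonempty →
      QEC (corona G H) = max (psiStarInv (H.adjMatrix ℝ) (QEC G))
        (sSup (lambdaS (corona G H) ∩
          {lam : ℝ | (H.adjMatrix ℝ + (2 + lam) • (1 : Matrix V₂ V₂ ℝ)).det = 0}))) := by
  set A := H.adjMatrix ℝ with hAdef
  have : Nonempty V₂ := Fintype.card_pos_iff.1 hV₂
  have hA : ∃ α ∈ mainEv A, α ≠ -2 := exists_mainEv_ne adjMatrix_isHermitian fun i j => by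
    rw [hAdef, SimpleGraph.adjMatrix_apply]
    split_ifs <;> norm_num
  obtain ⟨hlt, hpsi⟩ := psiStarInv_spec hA (QEC G)
  set L := psiStarInv A (QEC G)
  have hcard : 2 ≤ Fintype.card (V₁ × Option V₂) := by
    rw [Fintype.card_prod]
    exact hV₁.trans (Nat.le_mul_of_pos_right _ Fintype.card_pos)
  have hQ := QEC_mem_lambdaS (corona G H) hcard
  have hdom : ∀ lam, -2 - lam ∉ evSet A → lam ∈ omegaDomain A := by
    rintro lam hlam α hα rfl
    exact hlam (by rw [show -2 - (-α - 2) = α by ring]; exact mainEv_subset_evSet hα.1)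
  have hωL : omegaFun A L ≠ 0 := fun h =>
    absurd ((isGreatest_lamStar hA).2 ⟨hdom L hev, h⟩) (not_le.2 hlt)
  have hLQ : L ≤ QEC (corona G H) := le_QEC_of_mem_lambdaS _
    (mem_lambdaS_corona hG hev hωL (hpsi.symm ▸ QEC_mem_lambdaS G hV₁))
  have hQL : -2 - QEC (corona G H) ∉ evSet A → QEC (corona G H) ≤ L := by
    intro hev'
    by_cases hω : omegaFun A (QEC (corona G H)) = 0
    · exact ((isGreatest_lamStar hA).2 ⟨hdom _ hev', hω⟩).trans hlt.le
    · by_contra! hcon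
      have h1 := psiFun_strictMonoOn hA hlt (hlt.trans hcon) hcon
      have h2 := le_QEC_of_mem_lambdaS G (psiFun_mem_lambdaS hG hev' hω hQ)
      rw [hpsi] at h1
      exact absurd h2 (not_le.2 h1)
  set T := lambdaS (corona G H) ∩
    {lam : ℝ | (A + (2 + lam) • (1 : Matrix V₂ V₂ ℝ)).det = 0}
  have hTle : ∀ lam ∈ T, lam ≤ QEC (corona G H) := fun lam h => le_QEC_of_mem_lambdaS _ h.1
  refine ⟨fun hempty => le_antisymm (hQL fun h => ?_) hLQ, fun hne => le_antisymm ?_ ?_⟩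
  · exact hempty.le ⟨hQ, (det_shift_eq_zero_iff A _).2 h⟩
  · by_cases h : -2 - QEC (corona G H) ∈ evSet A
    · exact le_max_of_le_right (le_csSup ⟨_, hTle⟩ ⟨hQ, (det_shift_eq_zero_iff A _).2 h⟩)
    · exact le_max_of_le_left (hQL h)
  · exact max_le hLQ (csSup_le hne hTle)

end QECPaper
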